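/- Let η be any ball configuration, let 𝒲 be its carrier with seat numbers, and let T𝒲 be the carrier with seat numbers of the time-evolved configuration Tη. Then for every k ∈ ℕ and x ∈ ℤ_{≥0}, 1 − (T𝒲)_k(x) ≥ 𝒲_k(x); equivalently, 𝒲_k(x) + (T𝒲)_k(x) ≤ 1. -/

import Mathlib

open Finset

namespace BBS

attribute [local instance] Classical.propDecidable

noncomputable section

/-- A ball configuration: `η x ∈ {0,1}`; the sites are `x = 1, 2, ...` and
the index `0` is never used. -/
def IsConf (η : ℕ → ℤ) : Prop := ∀ x, η x = 0 ∨ η x = 1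

/-- The carrier with seat numbers: `W η x k = 𝒲_k(x)` (seats `k = 1, 2, ...`). -/
def W (η : ℕ → ℤ) : ℕ → ℕ → ℤ
  | 0 => fun _ => 0
  | x + 1 => fun k =>
      W η x k
        + η (x + 1) * (1 - W η x k) * ∏ ℓ ∈ Finset.Icc 1 (k - 1), W η x ℓ
        - (1 - η (x + 1)) * W η x k * ∏ ℓ ∈ Finset.Icc 1 (k - 1), (1 - W η x ℓ)

/-- The seat number configuration `η↑_k(x)`. -/
def up (η : ℕ → ℤ) (k x : ℕ) : ℤ :=
  η x * (1 - W η (x - 1) k) * ∏ ℓ ∈ Finset.Icc 1 (k - 1), W η (x - 1) ℓ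

/-- The seat number configuration `η↓_k(x)`. -/
def down (η : ℕ → ℤ) (k x : ℕ) : ℤ :=
  (1 - η x) * W η (x - 1) k * ∏ ℓ ∈ Finset.Icc 1 (k - 1), (1 - W η (x - 1) ℓ)

/-- The record indicator `r(x) = 1 - ∑_{k ∈ ℕ} (η↑_k(x) + η↓_k(x))`. -/
def rcd (η : ℕ → ℤ) (x : ℕ) : ℤ :=
  1 - ∑' k : ℕ, if 1 ≤ k then up η k x + down η k x else 0

/-- `m^σ_k(x) = ∑_{y=1}^x (η^σ_k(y) - η^σ_{k+1}(y))`, generic in the seat family `e`. -/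
def mSeq (e : ℕ → ℕ → ℤ) (k x : ℕ) : ℤ :=
  ∑ y ∈ Finset.Icc 1 x, (e k y - e (k + 1) y)

/-- `m↑_k(x)` -/
def mUp (η : ℕ → ℤ) : ℕ → ℕ → ℤ := mSeq (up η)

/-- `m↓_k(x)` -/
def mDown (η : ℕ → ℤ) : ℕ → ℕ → ℤ := mSeq (down η)

/-- `ξ_k(x) = x - ∑_{ℓ=1}^k ∑_{y=1}^x (η↑_ℓ(y) + η↓_ℓ(y))`. -/
def xi (η : ℕ → ℤ) (k x : ℕ) : ℤ :=
  (x : ℤ) - ∑ ℓ ∈ Finset.Icc 1 k, ∑ y ∈ Finset.Icc 1 x, (up η ℓ y + down η ℓ y)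

/-- `{x : m↑_k(x) ≥ j ∧ m↓_k(x) ≥ j}`; `τ_k(j) < ∞` iff this set is nonempty. -/
def tauSet (η : ℕ → ℤ) (k j : ℕ) : Set ℕ :=
  {x : ℕ | (j : ℤ) ≤ mUp η k x ∧ (j : ℤ) ≤ mDown η k x}

/-- `τ_k(j)` (with junk value `0` when `τ_k(j) = ∞`). -/
def tau (η : ℕ → ℤ) (k j : ℕ) : ℕ := sInf (tauSet η k j)

/-- `ζ_k(i)`, the number of `j` with `τ_k(j) < ∞` at effective position `ξ_k(τ_k(j)) = i`. -/
def zeta (η : ℕ → ℤ) (k : ℕ) (i : ℤ) : ℕ :=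
  Set.ncard {j : ℕ | 1 ≤ j ∧ (tauSet η k j).Nonempty ∧ xi η k (tau η k j) = i}

/-- `{x : ξ_k(x) = i}`; `s_k(i) < ∞` iff this set is nonempty. -/
def sSet (η : ℕ → ℤ) (k : ℕ) (i : ℤ) : Set ℕ := {x : ℕ | xi η k x = i}

/-- `s_k(i)` (with junk value `0` when `s_k(i) = ∞`). -/
def sPos (η : ℕ → ℤ) (k : ℕ) (i : ℤ) : ℕ := sInf (sSet η k i)

/-- The carrier with infinite capacity: `carrier η x = W_∞(x)`. -/
def carrier (η : ℕ → ℤ) : ℕ → ℤ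
  | 0 => 0
  | x + 1 => carrier η x + η (x + 1) - min (1 - η (x + 1)) (carrier η x)

/-- The BBS time evolution `T`. -/
def Tev (η : ℕ → ℤ) (x : ℕ) : ℤ := η x + carrier η (x - 1) - carrier η x

/-- The carrier with capacity `c ∈ ℕ ∪ {∞}`. -/
def carrierC (c : ℕ∞) (η : ℕ → ℤ) : ℕ → ℤ
  | 0 => 0
  | x + 1 =>
      carrierC c η x
        + (if c = ⊤ then η (x + 1)
            else min (η (x + 1)) (((c.toNat : ℕ) : ℤ) - carrierC c η x))
        - min (1 - η (x + 1)) (carrierC c η x)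

/-- The BBS time evolution `T_ℓ` with carrier capacity `ℓ = c`. -/
def TevC (c : ℕ∞) (η : ℕ → ℤ) (x : ℕ) : ℤ :=
  η x + carrierC c η (x - 1) - carrierC c η x

/-- `p^σ_k(x) = x - 2 ∑_{ℓ=1}^k ∑_{y=1}^x η^σ_ℓ(y)`, generic in the seat family `e`. -/
def pSeat (e : ℕ → ℕ → ℤ) (k x : ℕ) : ℤ :=
  (x : ℤ) - 2 * ∑ ℓ ∈ Finset.Icc 1 k, ∑ y ∈ Finset.Icc 1 x, e ℓ y

/-- `t^σ_k(x,j) = max{1 ≤ y ≤ x : m^σ_k(y) = j, η^σ_k(y) = 1}`. -/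
def tmax (e : ℕ → ℕ → ℤ) (k x : ℕ) (j : ℤ) : ℕ :=
  sSup {y : ℕ | 1 ≤ y ∧ y ≤ x ∧ mSeq e k y = j ∧ e k y = 1}

/-- The largest entry of a multiset of integers (junk for the empty multiset). -/
def maxE (s : Multiset ℤ) : ℤ := sSup {a : ℤ | a ∈ s}

/-- The refined rigging algorithm: `rigSeq e x k` is the multiset of entries of the
array `J^σ_k(x)`, where `e = η^σ`. -/
def rigSeq (e : ℕ → ℕ → ℤ) : ℕ → ℕ → Multiset ℤ
  | 0 => fun _ => 0
  | x + 1 =>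
      let J := rigSeq e x
      let k1 := sSup {k : ℕ | 1 ≤ k ∧ e k (x + 1) = 1}
      if k1 = 0 then J
      else fun j =>
        if j = k1 then pSeat e k1 (x + 1) ::ₘ J j
        else if 1 ≤ j ∧ j + 1 = k1 then (J j).erase (maxE (J j))
        else J j

/-- The KKR algorithm: `kkr η x k` is the multiset of rigging entries attached to the
rows of length `k` of the rigged partition `(μ(x), J(x))`. -/
def kkr (η : ℕ → ℤ) : ℕ → ℕ → Multiset ℤ
  | 0 => fun _ => 0
  | x + 1 =>
      let R := kkr η x
      if η (x + 1) = 1 then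
        -- the vacancy `p_k(x)` of the current rigged partition
        let p : ℕ → ℤ := fun k =>
          (x : ℤ) - 2 * ∑' j : ℕ, ((R j).card : ℤ) * min (j : ℤ) (k : ℤ)
        -- the maximal length of a singular row (`0` if there is none)
        let k0 : ℕ := sSup {k : ℕ | 1 ≤ k ∧ p k ∈ R k ∧ ∀ a ∈ R k, a ≤ p k}
        -- the multiplicities of the new partition `μ(x+1)`
        let m' : ℕ → ℤ := fun j =>
          ((R j).card : ℤ) + (if j = k0 + 1 then 1 else 0) - (if 1 ≤ j ∧ j = k0 then 1 else 0)
        -- the vacancy `p_{k0+1}(x+1)` of the new rigged partition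
        let p' : ℤ := ((x : ℤ) + 1) - 2 * ∑' j : ℕ, m' j * min (j : ℤ) ((k0 : ℤ) + 1)
        fun k =>
          if k = k0 + 1 then p' ::ₘ R k
          else if k = k0 then (R k).erase (p k0)
          else R k
      else R

/-- The conjugate partition `λ_k(x)` of `μ(x)` in the KKR algorithm. -/
def lamKKR (η : ℕ → ℤ) (k x : ℕ) : ℤ :=
  ∑' j : ℕ, if k ≤ j then ((kkr η x j).card : ℤ) else 0

/-- The vacancy `p_k(x) = x - 2 ∑_i min{μ_i(x), k}` in the KKR algorithm. -/
def pKKR (η : ℕ → ℤ) (k x : ℕ) : ℤ :=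
  (x : ℤ) - 2 * ∑' j : ℕ, ((kkr η x j).card : ℤ) * min (j : ℤ) (k : ℤ)

/-! Interlacing Young diagrams.  A Young diagram is encoded as the multiset of its
(positive) row lengths. -/

/-- The conjugate partition: `conj μ k = λ_k`, the number of rows of length `≥ k`. -/
def conj (μ : Multiset ℕ) (k : ℕ) : ℕ := (μ.filter (fun r => k ≤ r)).card

/-- `(μ↑, μ↓)` is interlacing: `μ↑_1 ≥ μ↓_1 ≥ μ↑_2 ≥ μ↓_2 ≥ ⋯`, equivalently
`λ↑_k − λ↓_k ∈ {0,1}` for all `k ≥ 1`. -/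
def Interlacing (a b : Multiset ℕ) : Prop :=
  ∀ k, 1 ≤ k → conj b k ≤ conj a k ∧ conj a k ≤ conj b k + 1

/-- `{k ≥ 1 : λ↑_ℓ − λ↓_ℓ = 1 for all 1 ≤ ℓ ≤ k}`. -/
def kUpSet (a b : Multiset ℕ) : Set ℕ :=
  {k : ℕ | 1 ≤ k ∧ ∀ ℓ, 1 ≤ ℓ → ℓ ≤ k → conj a ℓ = conj b ℓ + 1}

/-- `{k ≥ 1 : λ↑_ℓ − λ↓_ℓ = 0 for all 1 ≤ ℓ ≤ k}`. -/
def kDownSet (a b : Multiset ℕ) : Set ℕ :=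
  {k : ℕ | 1 ≤ k ∧ ∀ ℓ, 1 ≤ ℓ → ℓ ≤ k → conj a ℓ = conj b ℓ}

/-- `k↑` (with `sup ∅ = 0`). -/
def kUp (a b : Multiset ℕ) : ℕ := sSup (kUpSet a b)

/-- `k↓` (with `sup ∅ = 0`; junk value `0` also when `k↓ = ∞`, i.e. `μ↑ = μ↓`). -/
def kDown (a b : Multiset ℕ) : ℕ := sSup (kDownSet a b)

/-- Add one box to a row of length `k` (a new row of length `1` is added if `k = 0`). -/
def addBox (μ : Multiset ℕ) (k : ℕ) : Multiset ℕ := (k + 1) ::ₘ μ.erase k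

/-- The interlacing-diagrams algorithm producing `(μ↑(x), μ↓(x))`. -/
def ydPair (η : ℕ → ℤ) : ℕ → Multiset ℕ × Multiset ℕ
  | 0 => (0, 0)
  | x + 1 =>
      let P := ydPair η x
      if η (x + 1) = 1 then (addBox P.1 (kUp P.1 P.2), P.2)
      else if P.1 ≠ P.2 then (P.1, addBox P.2 (kDown P.1 P.2))
      else P

/-! The Takahashi–Satsuma algorithm and the slot configuration.  The state of the
algorithm is the set `C` of crossed-out sites. -/

/-- The sites not yet crossed out. -/
def active (C : Set ℕ) : Set ℕ := {x | 1 ≤ x ∧ x ∉ C}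

/-- The maximal run (of consecutive equal letters among uncrossed sites) containing `x`. -/
def runOf (η : ℕ → ℤ) (C : Set ℕ) (x : ℕ) : Set ℕ :=
  {y | x ∈ active C ∧ y ∈ active C ∧
    ∀ z ∈ active C, min x y ≤ z → z ≤ max x y → η z = η x}

/-- The length of the run containing `x`, in `ℕ∞`. -/
def runLen (η : ℕ → ℤ) (C : Set ℕ) (x : ℕ) : ℕ∞ :=
  if (runOf η C x).Infinite then ⊤ else ((runOf η C x).ncard : ℕ∞)

/-- The first sites of runs qualifying for the TS step: the run has a preceding run and
is at least as long as it. -/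
def qualSet (η : ℕ → ℤ) (C : Set ℕ) : Set ℕ :=
  {b | b ∈ active C ∧ sInf (runOf η C b) = b ∧
    {y ∈ active C | y < b}.Nonempty ∧
    runLen η C (sSup {y ∈ active C | y < b}) ≤ runLen η C b}

/-- The first site of the leftmost qualifying run. -/
def bSel (η : ℕ → ℤ) (C : Set ℕ) : ℕ := sInf (qualSet η C)

/-- The last site of the run preceding the selected run. -/
def prevSel (η : ℕ → ℤ) (C : Set ℕ) : ℕ :=
  sSup {y ∈ active C | y < bSel η C}

/-- The last `k` letters of the preceding run (the whole preceding run, whose length is `k`). -/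
def S1 (η : ℕ → ℤ) (C : Set ℕ) : Set ℕ := runOf η C (prevSel η C)

/-- The first `k` letters of the selected run. -/
def S2 (η : ℕ → ℤ) (C : Set ℕ) : Set ℕ :=
  {y ∈ runOf η C (bSel η C) |
    ({z ∈ runOf η C (bSel η C) | z ≤ y}).ncard ≤ (S1 η C).ncard}

/-- One step of the TS algorithm: cross out the identified soliton (if any run qualifies). -/
def tsStep (η : ℕ → ℤ) (C : Set ℕ) : Set ℕ :=
  if (qualSet η C).Nonempty then C ∪ S1 η C ∪ S2 η C else C

/-- The crossed-out sites after `n` steps of the TS algorithm. -/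
def tsC (η : ℕ → ℤ) : ℕ → Set ℕ
  | 0 => ∅
  | n + 1 => tsStep η (tsC η n)

/-- The slot configuration `ν : ℕ → ℤ_{≥0} ∪ {∞}`: for a `k`-soliton
`γ = {z_1 < ⋯ < z_{2k}}`, `ν(z_l) = ν(z_{l+k}) = l − 1`, and `ν(x) = ∞` for records. -/
def nuTS (η : ℕ → ℤ) (z : ℕ) : ℕ∞ :=
  if _h : ∃ n, z ∈ tsC η (n + 1) ∧ z ∉ tsC η n then
    let n := sInf {n : ℕ | z ∈ tsC η (n + 1) ∧ z ∉ tsC η n}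
    if z ∈ S1 η (tsC η n) then (({w ∈ S1 η (tsC η n) | w < z}).ncard : ℕ∞)
    else (({w ∈ S2 η (tsC η n) | w < z}).ncard : ℕ∞)
  else ⊤

/-- `ξ̃_k(x)`, the number of `k`-slots in `[1,x]`. -/
def xiTS (η : ℕ → ℤ) (k x : ℕ) : ℕ :=
  Set.ncard {y : ℕ | 1 ≤ y ∧ y ≤ x ∧ (k : ℕ∞) ≤ nuTS η y}

/-- `s̃_k(i)`, the position of the `i`-th `k`-slot. -/
def sTS (η : ℕ → ℤ) (k i : ℕ) : ℕ := sInf {x : ℕ | xiTS η k x = i}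

/-- The slot decomposition `ζ̃_k(i)`: the number of `k`-solitons appended to the
`i`-th `k`-slot. -/
def zetaTS (η : ℕ → ℤ) (k i : ℕ) : ℕ :=
  Set.ncard {n : ℕ | (qualSet η (tsC η n)).Nonempty ∧ (S1 η (tsC η n)).ncard = k ∧
    ∀ z ∈ S1 η (tsC η n) ∪ S2 η (tsC η n), sTS η k i ≤ z ∧ z ≤ sTS η k (i + 1) - 1}

end

end BBS

namespace BBS

lemma prod_eq_zero_or_one {ι : Type*} (s : Finset ι) (f : ι → ℤ)
    (hf : ∀ i ∈ s, f i = 0 ∨ f i = 1) : ∏ i ∈ s, f i = 0 ∨ ∏ i ∈ s, f i = 1 := by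
  by_cases h : ∃ i ∈ s, f i = 0
  · obtain ⟨i, hi, h0⟩ := h
    exact Or.inl (Finset.prod_eq_zero hi h0)
  · push Not at h
    exact Or.inr (Finset.prod_eq_one fun i hi => (hf i hi).resolve_left (h i hi))

lemma W_succ (η : ℕ → ℤ) (x k : ℕ) :
    W η (x + 1) k = W η x k
        + η (x + 1) * (1 - W η x k) * ∏ ℓ ∈ Finset.Icc 1 (k - 1), W η x ℓ
        - (1 - η (x + 1)) * W η x k * ∏ ℓ ∈ Finset.Icc 1 (k - 1), (1 - W η x ℓ) := rfl

lemma W_eq_zero_or_one {η : ℕ → ℤ} (hη : IsConf η) (x k : ℕ) :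
    W η x k = 0 ∨ W η x k = 1 := by
  induction x generalizing k with
  | zero => exact Or.inl rfl
  | succ x ih =>
    rw [W_succ]
    have hP := prod_eq_zero_or_one (Finset.Icc 1 (k - 1)) (fun ℓ => W η x ℓ) fun ℓ _ => ih ℓ
    have hQ := prod_eq_zero_or_one (Finset.Icc 1 (k - 1)) (fun ℓ => 1 - W η x ℓ)
      fun ℓ _ => by have := ih ℓ; omega
    rcases hη (x + 1) with h | h <;> rcases ih k with h' | h' <;> rcases hP with hP | hP <;>
      rcases hQ with hQ | hQ <;> simp [h, h', hP, hQ]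

lemma W_nonneg {η : ℕ → ℤ} (hη : IsConf η) (x k : ℕ) : 0 ≤ W η x k := by
  have := W_eq_zero_or_one hη x k
  omega

lemma sum_W_succ (η : ℕ → ℤ) (x n : ℕ) :
    ∑ k ∈ Finset.Icc 1 n, W η (x + 1) k = ∑ k ∈ Finset.Icc 1 n, W η x k
      + η (x + 1) * (1 - ∏ k ∈ Finset.Icc 1 n, W η x k)
      - (1 - η (x + 1)) * (1 - ∏ k ∈ Finset.Icc 1 n, (1 - W η x k)) := by
  induction n with
  | zero => simp
  | succ n ih =>
    simp only [Finset.sum_Icc_succ_top (Nat.le_add_left 1 n),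
      Finset.prod_Icc_succ_top (Nat.le_add_left 1 n), ih]
    rw [W_succ, Nat.add_sub_cancel]
    ring

lemma carrier_succ (η : ℕ → ℤ) (x : ℕ) :
    carrier η (x + 1) = carrier η x + η (x + 1) - min (1 - η (x + 1)) (carrier η x) := rfl

lemma carrier_nonneg {η : ℕ → ℤ} (hη : IsConf η) (x : ℕ) : 0 ≤ carrier η x := by
  induction x with
  | zero => exact le_rfl
  | succ x ih =>
    rw [carrier_succ]
    have := hη (x + 1)
    omega

lemma sum_W_le_carrier {η : ℕ → ℤ} (hη : IsConf η) (x n : ℕ) :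
    ∑ k ∈ Finset.Icc 1 n, W η x k ≤ carrier η x := by
  induction x with
  | zero => simp [W, carrier]
  | succ x ih =>
    rw [sum_W_succ, carrier_succ]
    have hc := carrier_nonneg hη x
    rcases hη (x + 1) with h | h
    · rw [h]
      by_cases h1 : ∃ k ∈ Finset.Icc 1 n, W η x k = 1
      · obtain ⟨k, hk, h1⟩ := h1
        rw [Finset.prod_eq_zero (f := fun k => 1 - W η x k) hk (by simp [h1])]
        omega
      · push Not at h1
        have h0 : ∀ k ∈ Finset.Icc 1 n, W η x k = 0 := fun k hk =>
          (W_eq_zero_or_one hη x k).resolve_right (h1 k hk)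
        have hQ : ∏ k ∈ Finset.Icc 1 n, (1 - W η x k) = 1 :=
          Finset.prod_eq_one fun k hk => by rw [h0 k hk, sub_zero]
        rw [Finset.sum_eq_zero h0, hQ]
        omega
    · have hP := prod_eq_zero_or_one (Finset.Icc 1 n) (fun k => W η x k)
        fun k _ => W_eq_zero_or_one hη x k
      rw [h]
      omega

lemma W_eq_zero_of_carrier_eq_zero {η : ℕ → ℤ} (hη : IsConf η) {x : ℕ}
    (h : carrier η x = 0) {k : ℕ} (hk : 1 ≤ k) : W η x k = 0 := by
  have hle : W η x k ≤ ∑ ℓ ∈ Finset.Icc 1 k, W η x ℓ :=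
    Finset.single_le_sum (fun ℓ _ => W_nonneg hη x ℓ) (Finset.mem_Icc.2 ⟨hk, le_rfl⟩)
  have := sum_W_le_carrier hη x k
  have := W_nonneg hη x k
  omega

lemma Tev_succ (η : ℕ → ℤ) (x : ℕ) :
    Tev η (x + 1) = min (1 - η (x + 1)) (carrier η x) := by
  simp only [Tev, carrier_succ, Nat.add_sub_cancel]
  ring

lemma isConf_Tev {η : ℕ → ℤ} (hη : IsConf η) : IsConf (Tev η) := by
  rintro (_ | x)
  · simpa [Tev] using hη 0
  · rw [Tev_succ]
    have := hη (x + 1)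
    have := carrier_nonneg hη x
    omega

lemma prod_le_prod_one_sub {a b : ℕ → ℤ} (ha : ∀ ℓ, 0 ≤ a ℓ)
    (hab : ∀ ℓ, 1 ≤ ℓ → a ℓ ≤ 1 - b ℓ) (n : ℕ) :
    ∏ ℓ ∈ Finset.Icc 1 n, a ℓ ≤ ∏ ℓ ∈ Finset.Icc 1 n, (1 - b ℓ) :=
  Finset.prod_le_prod (fun ℓ _ => ha ℓ) fun ℓ hℓ => hab ℓ (Finset.mem_Icc.1 hℓ).1

/-- Lemma 3.5: `𝒲̃_k(x) = 1 − (T𝒲)_k(x) ≥ 𝒲_k(x)`. -/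
theorem statement4 (η : ℕ → ℤ) (hη : IsConf η) (k : ℕ) (hk : 1 ≤ k) (x : ℕ) :
    W η x k ≤ 1 - W (Tev η) x k := by
  have hT := isConf_Tev hη
  induction x generalizing k with
  | zero => simp [W]
  | succ x ih =>
    have ha := W_eq_zero_or_one hη x
    have hb := W_eq_zero_or_one hT x
    have hab := ih k hk
    have hcar := carrier_nonneg hη x
    have hev := Tev_succ η x
    rcases hη (x + 1) with h | h
    · by_cases hc : carrier η x = 0
      · have hb' := W_eq_zero_or_one hT (x + 1) k
        rw [W_succ η, h, W_eq_zero_of_carrier_eq_zero hη hc hk]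
        omega
      · have ht : Tev η (x + 1) = 1 := by omega
        have hPQ := prod_le_prod_one_sub (W_nonneg hT x)
          (fun ℓ hℓ => by have := ih ℓ hℓ; omega) (b := W η x) (k - 1)
        have hP := prod_eq_zero_or_one (Finset.Icc 1 (k - 1)) _ fun ℓ _ => hb ℓ
        have hQ := prod_eq_zero_or_one (Finset.Icc 1 (k - 1)) (fun ℓ => 1 - W η x ℓ)
          fun ℓ _ => by have := ha ℓ; omega
        rw [W_succ η, W_succ (Tev η), h, ht]
        rcases ha k with h1 | h1 <;> rcases hb k with h2 | h2 <;> rw [h1, h2] <;> omega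
    · have ht : Tev η (x + 1) = 0 := by omega
      have hPQ := prod_le_prod_one_sub (W_nonneg hη x) ih (k - 1)
      have hP := prod_eq_zero_or_one (Finset.Icc 1 (k - 1)) _ fun ℓ _ => ha ℓ
      have hQ := prod_eq_zero_or_one (Finset.Icc 1 (k - 1)) (fun ℓ => 1 - W (Tev η) x ℓ)
        fun ℓ _ => by have := hb ℓ; omega
      rw [W_succ η, W_succ (Tev η), h, ht]
      rcases ha k with h1 | h1 <;> rcases hb k with h2 | h2 <;> rw [h1, h2] <;> omega

end BBS
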